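/- Let L be the entire continuation of the Cantor Dirichlet series (assumed to exist). Then for every ε > 0 there is a constant K such that for all real t ≥ 2, |L(1/2 + it)| ≤ K·t^{(1−d)/(2(2−d)) + ε}, where d = log 2 / log 3. (Numerically the exponent (1−d)/(2(2−d)) ≈ 0.1348, strictly below the convexity exponent 1/4.) -/

import Mathlib

open Complex Real

/-- `r(n) = ∏_{j=1}^∞ cos(3n/(4·3^j))`: the real cosine product giving the
Fourier coefficients of the ternary Cantor measure rescaled to `[0.5, 2.0]`. -/
noncomputable def cantorR (n : ℕ) : ℝ :=
  ∏' j : ℕ, Real.cos (3 * n / (4 * 3 ^ (j + 1)))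

/-- `â(n) = e^{i(5/4)n} r(n)`: the Fourier coefficients of the rescaled ternary
Cantor measure. -/
noncomputable def cantorA (n : ℕ) : ℂ :=
  Complex.exp (Complex.I * (5 / 4) * n) * (cantorR n : ℂ)

/-- The Cantor Dirichlet series `∑_{n≥1} â(n) n^{-s}` (as a `tsum`). -/
noncomputable def cantorSeries (s : ℂ) : ℂ :=
  ∑' n : ℕ, cantorA (n + 1) * ((n + 1 : ℕ) : ℂ) ^ (-s)

/-- `d = log 2 / log 3`, the Hausdorff dimension of the ternary Cantor set. -/
noncomputable def cantorDim : ℝ := Real.log 2 / Real.log 3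


namespace CantorAux

lemma abel_aux (w : ℕ → ℝ) (z : ℕ → ℂ) (B : ℝ) (m : ℕ)
    (hw : ∀ i, i < m → w (i + 1) ≤ w i)
    (hZ : ∀ j, j ≤ m → ‖∑ i ∈ Finset.range j, z i‖ ≤ B) :
    ‖∑ i ∈ Finset.range (m + 1), (w i : ℂ) * z i
      - w m * ∑ i ∈ Finset.range (m + 1), z i‖ ≤ (w 0 - w m) * B := by
  induction m with
  | zero => simp
  | succ m ih =>
    have h1 := ih (fun i hi => hw i (by omega)) (fun j hj => hZ j (by omega))
    have h2 := hZ (m + 1) le_rfl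
    have h3 := hw m (by omega)
    have e : ∑ i ∈ Finset.range (m + 1 + 1), (w i : ℂ) * z i
        - w (m + 1) * ∑ i ∈ Finset.range (m + 1 + 1), z i
        = (∑ i ∈ Finset.range (m + 1), (w i : ℂ) * z i
            - w m * ∑ i ∈ Finset.range (m + 1), z i)
          + ((w m - w (m + 1) : ℝ) : ℂ) * ∑ i ∈ Finset.range (m + 1), z i := by
      rw [Finset.sum_range_succ _ (m + 1), Finset.sum_range_succ z (m + 1)]
      push_cast
      ring
    rw [e]
    refine (norm_add_le _ _).trans ?_
    rw [norm_mul, Complex.norm_real, Real.norm_of_nonneg (by linarith)]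
    nlinarith [mul_le_mul_of_nonneg_left h2 (by linarith : 0 ≤ w m - w (m + 1))]

lemma abel (w : ℕ → ℝ) (z : ℕ → ℂ) (B W : ℝ) (m : ℕ) (hW : 0 ≤ W) (hB : 0 ≤ B)
    (hw : ∀ i, i + 1 < m → w (i + 1) ≤ w i) (hw0 : ∀ i, i < m → 0 ≤ w i)
    (hwW : ∀ i, i < m → w i ≤ W)
    (hZ : ∀ j, j ≤ m → ‖∑ i ∈ Finset.range j, z i‖ ≤ B) :
    ‖∑ i ∈ Finset.range m, (w i : ℂ) * z i‖ ≤ W * B := by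
  rcases m with _ | m
  · simp; positivity
  have h := abel_aux w z B m (fun i hi => hw i (by omega)) (fun j hj => hZ j (by omega))
  have h2 := hZ (m + 1) le_rfl
  have h3 : ‖(w m : ℂ) * ∑ i ∈ Finset.range (m + 1), z i‖ ≤ w m * B := by
    rw [norm_mul, Complex.norm_real, Real.norm_of_nonneg (hw0 m (by omega))]
    exact mul_le_mul_of_nonneg_left h2 (hw0 m (by omega))
  have h4 := norm_add_le (∑ i ∈ Finset.range (m + 1), (w i : ℂ) * z i
      - w m * ∑ i ∈ Finset.range (m + 1), z i) ((w m : ℂ) * ∑ i ∈ Finset.range (m + 1), z i)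
  rw [sub_add_cancel] at h4
  have h5 := mul_le_mul_of_nonneg_right (hwW 0 (by omega)) hB
  linarith

/-- Kusmin-Landau, basic version on `range`. -/
lemma KL0 (f : ℕ → ℝ) (m : ℕ) (δ : ℝ) (hδ : 0 < δ)
    (hmono : ∀ i, i + 1 < m → f (i + 1) - f i ≤ f (i + 2) - f (i + 1))
    (hlo : ∀ i, i < m → δ ≤ f (i + 1) - f i)
    (hhi : ∀ i, i < m → f (i + 1) - f i ≤ 2 * π - δ) :
    ‖∑ i ∈ Finset.range m, Complex.exp (Complex.I * (f i : ℂ))‖ ≤ 24 / δ := by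
  rcases Nat.eq_zero_or_pos m with rfl | hm
  · simp; positivity
  have hδπ : δ ≤ π := by have := hlo 0 hm; have := hhi 0 hm; linarith
  have hπ := Real.pi_gt_three
  have hπ4 := Real.pi_lt_d2
  set g : ℕ → ℝ := fun i => (f (i + 1) - f i) / 2 with hg
  set h : ℕ → ℝ := fun i => Real.cos (g i) / Real.sin (g i) with hh
  set E : ℕ → ℂ := fun i => Complex.exp (Complex.I * (f i : ℂ)) with hE
  have hg1 : ∀ i, i < m → δ / 2 ≤ g i := fun i hi => by
    have := hlo i hi; simp only [hg]; linarith
  have hg2 : ∀ i, i < m → g i ≤ π - δ / 2 := fun i hi => by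
    have := hhi i hi; simp only [hg]; linarith
  have hsin : ∀ i, i < m → δ / π ≤ Real.sin (g i) := by
    intro i hi
    have h1 := hg1 i hi
    have h2 := hg2 i hi
    rcases le_total (g i) (π / 2) with h3 | h3
    · have := Real.mul_le_sin (x := g i) (by linarith) h3
      refine le_trans ?_ this
      rw [div_mul_eq_mul_div, div_le_div_iff_of_pos_right (by positivity)]
      linarith
    · have := Real.mul_le_sin (x := π - g i) (by linarith) (by linarith)
      rw [Real.sin_pi_sub] at this
      refine le_trans ?_ this
      rw [div_mul_eq_mul_div, div_le_div_iff_of_pos_right (by positivity)]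
      linarith
  have hsin0 : ∀ i, i < m → 0 < Real.sin (g i) := fun i hi =>
    lt_of_lt_of_le (by positivity) (hsin i hi)
  have hhb : ∀ i, i < m → |h i| ≤ π / δ := by
    intro i hi
    simp only [hh]
    rw [abs_div, abs_of_pos (hsin0 i hi), div_le_div_iff₀ (hsin0 i hi) hδ]
    have h1 := hsin i hi
    rw [div_le_iff₀ (by positivity)] at h1
    have h2 := Real.abs_cos_le_one (g i)
    nlinarith
  have hanti : ∀ i, i + 1 < m → h (i + 1) ≤ h i := by
    intro i hi
    have s0 := hsin0 i (by omega)
    have s1 := hsin0 (i + 1) hi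
    simp only [hh]
    rw [div_le_div_iff₀ s1 s0]
    have h1 : 0 ≤ Real.sin (g (i + 1) - g i) := by
      apply Real.sin_nonneg_of_nonneg_of_le_pi
      · have := hmono i hi
        simp only [hg]; linarith [show f (i + 1 + 1) = f (i + 2) from rfl]
      · have := hg1 i (by omega); have := hg2 (i + 1) hi; linarith
    rw [Real.sin_sub] at h1
    nlinarith
  have key : ∀ i, i < m → E i = (1 / 2) * (E i - E (i + 1))
      + (Complex.I / 2) * ((h i : ℂ) * (E i - E (i + 1))) := by
    intro i hi
    have s0 := hsin0 i hi
    have e1 : E (i + 1) = E i * (Real.cos (g i) + Real.sin (g i) * Complex.I) ^ 2 := by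
      simp only [hE]
      push_cast
      rw [← Complex.exp_mul_I, ← Complex.exp_nat_mul, ← Complex.exp_add]
      congr 1
      simp only [hg]; push_cast; ring
    have e2 : (h i : ℂ) = Real.cos (g i) / Real.sin (g i) := by simp [hh]
    have s1 : (Real.sin (g i) : ℂ) ≠ 0 := by exact_mod_cast s0.ne'
    have s2 : (Real.sin (g i) : ℂ) ^ 2 = 1 - (Real.cos (g i) : ℂ) ^ 2 := by
      have := Real.sin_sq (g i); exact_mod_cast this
    rw [e1, e2]
    generalize (Real.sin (g i) : ℂ) = S at *
    generalize (Real.cos (g i) : ℂ) = C at *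
    field_simp
    have hC : C ^ 2 = 1 - S ^ 2 := by rw [s2]; ring
    have hC3 : C ^ 3 = C * (1 - S ^ 2) := by rw [← hC]; ring
    have hI : Complex.I ^ 2 = -1 := Complex.I_sq
    have hI3 : Complex.I ^ 3 = - Complex.I := by rw [pow_succ, hI]; ring
    ring_nf
    simp only [hC, hC3, hI, hI3]
    ring
  have hEn : ∀ i, ‖E i‖ = 1 := by
    intro i; simp only [hE]; rw [mul_comm]; exact Complex.norm_exp_ofReal_mul_I _
  have hZ : ∀ j, ‖∑ i ∈ Finset.range j, (E i - E (i + 1))‖ ≤ 2 := by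
    intro j
    rw [Finset.sum_range_sub']
    refine (norm_sub_le _ _).trans ?_
    rw [hEn, hEn]; norm_num
  have hsum : ∑ i ∈ Finset.range m, E i = (1 / 2) * ∑ i ∈ Finset.range m, (E i - E (i + 1))
      + (Complex.I / 2) * (∑ i ∈ Finset.range m, ((h i + π / δ : ℝ) : ℂ) * (E i - E (i + 1))
        - ((π / δ : ℝ) : ℂ) * ∑ i ∈ Finset.range m, (E i - E (i + 1))) := by
    simp only [Finset.mul_sum, ← Finset.sum_sub_distrib, ← Finset.sum_add_distrib]
    refine Finset.sum_congr rfl fun i hi => ?_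
    refine (key i (Finset.mem_range.1 hi)).trans ?_
    push_cast
    ring
  have hπδ : 0 ≤ π / δ := by positivity
  have hA := abel (fun i => h i + π / δ) (fun i => E i - E (i + 1)) 2 (2 * (π / δ)) m
    (by positivity) (by norm_num) (fun i hi => by have := hanti i hi; simpa using this)
    (fun i hi => by have := abs_le.1 (hhb i hi); linarith [this.1])
    (fun i hi => by have := abs_le.1 (hhb i hi); linarith [this.2])
    (fun j _ => hZ j)
  have hZm := hZ m
  show ‖∑ i ∈ Finset.range m, E i‖ ≤ _
  rw [hsum]
  refine (norm_add_le _ _).trans ?_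
  rw [norm_mul, norm_mul]
  have n1 : ‖(1 / 2 : ℂ)‖ = 1 / 2 := by norm_num
  have n2 : ‖(Complex.I / 2 : ℂ)‖ = 1 / 2 := by simp
  rw [n1, n2]
  have h5 : ‖∑ i ∈ Finset.range m, ((h i + π / δ : ℝ) : ℂ) * (E i - E (i + 1))
        - ((π / δ : ℝ) : ℂ) * ∑ i ∈ Finset.range m, (E i - E (i + 1))‖
      ≤ 2 * (π / δ) * 2 + π / δ * 2 := by
    refine (norm_sub_le _ _).trans (add_le_add hA ?_)
    rw [norm_mul, Complex.norm_real, Real.norm_of_nonneg hπδ]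
    exact mul_le_mul_of_nonneg_left hZm hπδ
  have h6 : 1 + 3 * (π / δ) ≤ 24 / δ := by
    rw [← mul_div_assoc, ← sub_nonneg]
    have : 24 / δ - (1 + 3 * π / δ) = (24 - δ - 3 * π) / δ := by field_simp; ring
    rw [this]
    apply div_nonneg _ hδ.le
    linarith
  linarith

lemma KL (f : ℕ → ℝ) (a b : ℕ) (k : ℤ) (δ : ℝ) (hδ : 0 < δ)
    (hmono : ∀ i, a ≤ i → i + 1 < b → f (i + 1) - f i ≤ f (i + 2) - f (i + 1))
    (hlo : ∀ i, a ≤ i → i < b → 2 * π * k + δ ≤ f (i + 1) - f i)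
    (hhi : ∀ i, a ≤ i → i < b → f (i + 1) - f i ≤ 2 * π * k + 2 * π - δ) :
    ‖∑ i ∈ Finset.Ico a b, Complex.exp (Complex.I * (f i : ℂ))‖ ≤ 24 / δ := by
  rw [Finset.sum_Ico_eq_sum_range]
  have := KL0 (fun i => f (a + i) - 2 * π * k * (a + i : ℕ)) (b - a) δ hδ ?_ ?_ ?_
  · convert this using 3 with i hi
    push_cast
    rw [Complex.exp_eq_exp_iff_exists_int]
    refine ⟨k * (a + i : ℕ), ?_⟩
    push_cast
    ring
  · intro i hi
    have := hmono (a + i) (by omega) (by omega)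
    simp only [← add_assoc] at *
    push_cast at *
    linarith
  · intro i hi
    have := hlo (a + i) (by omega) (by omega)
    simp only [← add_assoc] at *
    push_cast at *
    linarith
  · intro i hi
    have := hhi (a + i) (by omega) (by omega)
    simp only [← add_assoc] at *
    push_cast at *
    linarith

lemma avg_cos (S : Finset ℕ) (c : ℕ → ℂ) (θ : ℕ → ℝ) (hθ : ∀ j, 0 ≤ θ j) (x B : ℝ) (k : ℕ) :
    ∀ r : ℝ, (∀ y, |y - x| ≤ r + ∑ j ∈ Finset.range k, θ j →
      ‖∑ n ∈ S, c n * Complex.exp (Complex.I * n * y)‖ ≤ B) →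
    ∀ y, |y - x| ≤ r →
      ‖∑ n ∈ S, c n * ((∏ j ∈ Finset.range k, Real.cos (n * θ j) : ℝ) : ℂ)
        * Complex.exp (Complex.I * n * y)‖ ≤ B := by
  induction k with
  | zero => intro r h y hy; simpa using h y (by simpa using hy)
  | succ k ih =>
    intro r h y hy
    have ih' := ih (r + θ k) (fun y hy => h y (by rw [Finset.sum_range_succ]; linarith))
    have hk := hθ k
    have hy' := abs_le.1 hy
    have h1 := ih' (y + θ k) (abs_le.2 ⟨by linarith [hy'.1], by linarith [hy'.2]⟩)
    have h2 := ih' (y - θ k) (abs_le.2 ⟨by linarith [hy'.1], by linarith [hy'.2]⟩)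
    have e : ∑ n ∈ S, c n * ((∏ j ∈ Finset.range (k + 1), Real.cos (n * θ j) : ℝ) : ℂ)
        * Complex.exp (Complex.I * n * y)
      = (1 / 2) * (∑ n ∈ S, c n * ((∏ j ∈ Finset.range k, Real.cos (n * θ j) : ℝ) : ℂ)
          * Complex.exp (Complex.I * n * ((y + θ k : ℝ) : ℂ))
        + ∑ n ∈ S, c n * ((∏ j ∈ Finset.range k, Real.cos (n * θ j) : ℝ) : ℂ)
          * Complex.exp (Complex.I * n * ((y - θ k : ℝ) : ℂ))) := by
      rw [← Finset.sum_add_distrib, Finset.mul_sum]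
      refine Finset.sum_congr rfl fun n _ => ?_
      rw [Finset.prod_range_succ]
      have e1 : Complex.exp (Complex.I * n * ((y + θ k : ℝ) : ℂ))
          = Complex.exp (Complex.I * n * y) * Complex.exp ((n * θ k : ℂ) * Complex.I) := by
        rw [← Complex.exp_add]; congr 1; push_cast; ring
      have e2 : Complex.exp (Complex.I * n * ((y - θ k : ℝ) : ℂ))
          = Complex.exp (Complex.I * n * y) * Complex.exp (-(n * θ k : ℂ) * Complex.I) := by
        rw [← Complex.exp_add]; congr 1; push_cast; ring
      have e3 : ((Real.cos (n * θ k) : ℝ) : ℂ) = (Complex.exp ((n * θ k : ℂ) * Complex.I)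
          + Complex.exp (-(n * θ k : ℂ) * Complex.I)) / 2 := by
        push_cast; rfl
      rw [Complex.ofReal_mul, e1, e2, e3]
      ring
    rw [e, norm_mul]
    have h3 := norm_add_le (∑ n ∈ S, c n * ((∏ j ∈ Finset.range k, Real.cos (n * θ j) : ℝ) : ℂ)
          * Complex.exp (Complex.I * n * ((y + θ k : ℝ) : ℂ)))
        (∑ n ∈ S, c n * ((∏ j ∈ Finset.range k, Real.cos (n * θ j) : ℝ) : ℂ)
          * Complex.exp (Complex.I * n * ((y - θ k : ℝ) : ℂ)))
    have n1 : ‖(1 / 2 : ℂ)‖ = 1 / 2 := by norm_num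
    rw [n1]
    linarith

noncomputable def th (j : ℕ) : ℝ := 1 / (4 * 3 ^ j)

lemma th_pos (j : ℕ) : 0 < th j := by unfold th; positivity

lemma th_succ (j : ℕ) : th (j + 1) = th j / 3 := by unfold th; rw [pow_succ]; field_simp

lemma th_le (j : ℕ) : th j ≤ 1 / 4 := by
  unfold th
  apply one_div_le_one_div_of_le (by norm_num)
  have : (1 : ℝ) ≤ 3 ^ j := one_le_pow₀ (by norm_num)
  linarith

lemma sum_th (m l : ℕ) : ∑ j ∈ Finset.range l, th (m + j) = 3 / 2 * (th m - th (m + l)) := by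
  induction l with
  | zero => simp
  | succ l ih => rw [Finset.sum_range_succ, ih, ← add_assoc, th_succ]; ring

lemma geom_bound (N : ℕ) (y δ : ℝ) (hδ : 0 < δ) (h1 : δ ≤ y) (h2 : y ≤ 2 * π - δ) :
    ‖∑ n ∈ Finset.Ico 0 N, Complex.exp (Complex.I * n * y)‖ ≤ 24 / δ := by
  have := KL (fun n => n * y) 0 N 0 δ hδ (fun i _ _ => by push_cast; linarith)
    (fun i _ _ => by push_cast; linarith) (fun i _ _ => by push_cast; linarith)
  convert this using 4 with n
  push_cast
  ring

lemma W_bound (N : ℕ) (l : ℕ) : ∀ m : ℕ,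
    ∑ n ∈ Finset.Ico 0 N, (∏ j ∈ Finset.range l, Real.cos (n * th (m + j))) ^ 2
      ≤ N / 2 ^ l + 96 * 3 ^ m * ((3 / 2) ^ l - 1) := by
  induction l with
  | zero => intro m; simp
  | succ l ih =>
    intro m
    have ih' := ih (m + 1)
    set p : ℕ → ℝ := fun n => ∏ j ∈ Finset.range l, Real.cos (n * th (m + 1 + j)) with hp
    have e : ∀ n : ℕ, (∏ j ∈ Finset.range (l + 1), Real.cos (n * th (m + j))) ^ 2
        = 1 / 2 * (p n) ^ 2 + 1 / 2 * (Real.cos (n * (2 * th m)) * (p n) ^ 2) := by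
      intro n
      rw [Finset.prod_range_succ']
      have : ∏ j ∈ Finset.range l, Real.cos (n * th (m + (j + 1))) = p n := by
        simp only [hp]; refine Finset.prod_congr rfl fun j _ => ?_
        congr 3; omega
      rw [this, show (n : ℝ) * (2 * th m) = 2 * (n * th m) by ring, Real.cos_two_mul]
      simp; ring
    have hs : ∑ j ∈ Finset.range l, th (m + 1 + j) ≤ th m / 2 := by
      rw [sum_th, th_succ]; have := th_pos (m + 1 + l); linarith
    have hm := th_pos m
    have hm4 := th_le m
    have hπ := Real.pi_gt_three
    have b1 := avg_cos (Finset.Ico 0 N) (fun n => 1) (fun j => th (m + 1 + j))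
      (fun j => (th_pos _).le) (2 * th m) (24 / th m) l (th m / 2) (by
        intro y hy
        have := abs_le.1 hy
        simp only [one_mul]
        exact geom_bound N y (th m) hm (by linarith) (by linarith))
    have b2 := avg_cos (Finset.Ico 0 N) (fun n => 1 * (p n : ℂ)) (fun j => th (m + 1 + j))
      (fun j => (th_pos _).le) (2 * th m) (24 / th m) l 0 (by
        intro y hy
        exact b1 y (by linarith))
      (2 * th m) (by simp)
    have b3 : |∑ n ∈ Finset.Ico 0 N, Real.cos (n * (2 * th m)) * (p n) ^ 2| ≤ 24 / th m := by
      refine le_trans ?_ b2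
      refine le_trans (le_of_eq ?_) (Complex.abs_re_le_norm _)
      rw [Complex.re_sum]
      congr 1
      refine Finset.sum_congr rfl fun n _ => ?_
      have : (1 * (p n : ℂ) * ((∏ j ∈ Finset.range l, Real.cos (n * th (m + 1 + j)) : ℝ) : ℂ))
          = ((p n ^ 2 : ℝ) : ℂ) := by
        rw [show (∏ j ∈ Finset.range l, Real.cos (n * th (m + 1 + j)) : ℝ) = p n from rfl]
        push_cast; ring
      rw [this, Complex.re_ofReal_mul,
        show Complex.I * n * ((2 * th m : ℝ) : ℂ) = ((n * (2 * th m) : ℝ) : ℂ) * Complex.I by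
          push_cast; ring, Complex.exp_ofReal_mul_I_re]
      ring
    have b4 : 24 / th m = 96 * 3 ^ m := by unfold th; field_simp; norm_num
    rw [b4] at b3
    have b5 := le_of_abs_le b3
    simp only [e]
    rw [Finset.sum_add_distrib, ← Finset.mul_sum, ← Finset.mul_sum]
    have : (N : ℝ) / 2 ^ (l + 1) + 96 * 3 ^ m * ((3 / 2) ^ (l + 1) - 1)
      = 1 / 2 * (N / 2 ^ l + 96 * 3 ^ (m + 1) * ((3 / 2) ^ l - 1)) + 1 / 2 * (96 * 3 ^ m) := by
      rw [pow_succ, pow_succ, pow_succ]; field_simp; ring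
    rw [this]
    linarith

lemma cantorR_eq (n : ℕ) : cantorR n = ∏' j : ℕ, Real.cos (n * th j) := by
  unfold cantorR th
  congr 1; funext j; congr 1
  rw [pow_succ]; field_simp

lemma cantorR_tendsto (n : ℕ) :
    Filter.Tendsto (fun k => ∏ j ∈ Finset.range k, Real.cos (n * th j)) Filter.atTop
      (nhds (cantorR n)) := by
  rw [cantorR_eq]
  apply HasProd.tendsto_prod_nat
  apply Multipliable.hasProd
  have : (fun j => Real.cos (n * th j)) = fun j => 1 + (Real.cos (n * th j) - 1) := by
    funext j; ring
  rw [this]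
  apply Real.multipliable_one_add_of_summable
  have hs : Summable (fun j : ℕ => (n : ℝ) ^ 2 * ((1 / 9 : ℝ) ^ j)) :=
    (summable_geometric_of_lt_one (by norm_num) (by norm_num)).mul_left _
  refine Summable.of_norm_bounded hs fun j => ?_
  rw [Real.norm_eq_abs, abs_sub_comm, abs_of_nonneg (by linarith [Real.cos_le_one (n * th j)])]
  have h1 := Real.one_sub_sq_div_two_le_cos (x := n * th j)
  have h2 : th j ^ 2 = 1 / 16 * (1 / 9 : ℝ) ^ j := by
    unfold th
    rw [div_pow, mul_pow, ← pow_mul, mul_comm j 2, pow_mul, div_pow]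
    norm_num
    ring
  have h3 : 0 ≤ (n : ℝ) ^ 2 * (1 / 9 : ℝ) ^ j := by positivity
  rw [mul_pow, h2] at h1
  linarith

lemma cantorR_sq_le (n k : ℕ) : cantorR n ^ 2 ≤ (∏ j ∈ Finset.range k, Real.cos (n * th j)) ^ 2 := by
  have h := (cantorR_tendsto n).pow 2
  refine le_of_tendsto h ?_
  filter_upwards [Filter.eventually_ge_atTop k] with m hm
  refine Nat.le_induction le_rfl ?_ m hm
  intro m _ ih
  refine le_trans ?_ ih
  rw [Finset.prod_range_succ, mul_pow]
  exact mul_le_of_le_one_right (sq_nonneg _) (Real.cos_sq_le_one _)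

lemma L2_bound (k : ℕ) : ∑ n ∈ Finset.Ico 0 (3 ^ k), cantorR n ^ 2 ≤ 97 * (3 / 2) ^ k := by
  have h := W_bound (3 ^ k) k 0
  have h1 : ∑ n ∈ Finset.Ico 0 (3 ^ k), cantorR n ^ 2
      ≤ ∑ n ∈ Finset.Ico 0 (3 ^ k), (∏ j ∈ Finset.range k, Real.cos ((n : ℕ) * th (0 + j))) ^ 2 := by
    refine Finset.sum_le_sum fun n _ => ?_
    simpa using cantorR_sq_le n k
  refine (h1.trans h).trans ?_
  push_cast
  rw [← div_pow]
  simp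
  nlinarith [show (0:ℝ) ≤ (3 / 2) ^ k by positivity]

/-- transfer from pointwise bounds to the Cantor coefficients -/
lemma transfer (S : Finset ℕ) (c : ℕ → ℂ) (B : ℝ)
    (h : ∀ y : ℝ, 1 / 2 ≤ y → y ≤ 2 →
      ‖∑ n ∈ S, c n * Complex.exp (Complex.I * n * y)‖ ≤ B) :
    ‖∑ n ∈ S, c n * cantorA n‖ ≤ B := by
  have ht : Filter.Tendsto (fun k => ‖∑ n ∈ S,
      c n * ((∏ j ∈ Finset.range k, Real.cos (n * th j) : ℝ) : ℂ)
        * Complex.exp (Complex.I * n * ((5 / 4 : ℝ) : ℂ))‖) Filter.atTop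
      (nhds ‖∑ n ∈ S, c n * (cantorR n : ℂ) * Complex.exp (Complex.I * n * ((5 / 4 : ℝ) : ℂ))‖) := by
    apply Filter.Tendsto.norm
    apply tendsto_finsetSum
    intro n _
    apply Filter.Tendsto.mul_const
    apply Filter.Tendsto.const_mul
    exact (Complex.continuous_ofReal.tendsto _).comp (cantorR_tendsto n)
  have e : ∑ n ∈ S, c n * cantorA n
      = ∑ n ∈ S, c n * (cantorR n : ℂ) * Complex.exp (Complex.I * n * ((5 / 4 : ℝ) : ℂ)) := by
    refine Finset.sum_congr rfl fun n _ => ?_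
    unfold cantorA
    rw [show Complex.I * (5 / 4) * (n : ℂ) = Complex.I * n * ((5 / 4 : ℝ) : ℂ) by push_cast; ring]
    ring
  rw [e]
  refine le_of_tendsto ht (Filter.Eventually.of_forall fun k => ?_)
  refine avg_cos S c th (fun j => (th_pos j).le) (5 / 4) B k 0 ?_ (5 / 4) (by simp)
  intro y hy
  have hs := sum_th 0 k
  simp only [zero_add] at hs
  have h0 : th 0 = 1 / 4 := by simp [th]
  have hk := th_pos k
  rw [hs, h0] at hy
  have := abs_le.1 hy
  exact h y (by linarith) (by linarith)

lemma norm_cantorA (n : ℕ) : ‖cantorA n‖ = |cantorR n| := by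
  unfold cantorA
  rw [norm_mul, Complex.norm_real, Real.norm_eq_abs,
    show Complex.I * (5 / 4) * (n : ℂ) = ((5 / 4 * n : ℝ) : ℂ) * Complex.I by push_cast; ring,
    Complex.norm_exp_ofReal_mul_I, one_mul]

lemma head_block (k : ℕ) :
    ∑ n ∈ Finset.Ico (3 ^ k) (3 ^ (k + 1)), |cantorR n| / √n ≤ 20 * √(3 / 2) ^ (k + 1) := by
  have h1 : ∑ n ∈ Finset.Ico (3 ^ k) (3 ^ (k + 1)), |cantorR n| / √n
      ≤ ∑ n ∈ Finset.Ico (3 ^ k) (3 ^ (k + 1)), |cantorR n| * (1 / √3 ^ k) := by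
    refine Finset.sum_le_sum fun n hn => ?_
    rw [Finset.mem_Ico] at hn
    rw [div_eq_mul_one_div]
    apply mul_le_mul_of_nonneg_left _ (abs_nonneg _)
    apply one_div_le_one_div_of_le (by positivity)
    apply Real.le_sqrt_of_sq_le
    rw [← pow_mul, mul_comm k 2, pow_mul, Real.sq_sqrt (by norm_num)]
    exact_mod_cast hn.1
  refine h1.trans ?_
  rw [← Finset.sum_mul]
  have h2 := Finset.sum_mul_sq_le_sq_mul_sq (Finset.Ico (3 ^ k) (3 ^ (k + 1)))
    (fun n => |cantorR n|) (fun _ => 1)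
  simp only [mul_one, sq_abs, one_pow, Finset.sum_const, nsmul_eq_mul, Nat.card_Ico] at h2
  have h3 : ∑ n ∈ Finset.Ico (3 ^ k) (3 ^ (k + 1)), cantorR n ^ 2 ≤ 97 * (3 / 2) ^ (k + 1) := by
    refine le_trans ?_ (L2_bound (k + 1))
    apply Finset.sum_le_sum_of_subset_of_nonneg
    · exact Finset.Ico_subset_Ico_left (Nat.zero_le _)
    · intros; positivity
  have h4 : (((3 ^ (k + 1) - 3 ^ k : ℕ)) : ℝ) = 2 * 3 ^ k := by
    have : (3 ^ (k + 1) - 3 ^ k : ℕ) = 2 * 3 ^ k := by rw [pow_succ]; omega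
    rw [this]; push_cast; ring
  rw [h4] at h2
  rw [mul_one_div, div_le_iff₀ (by positivity)]
  apply abs_le_of_sq_le_sq' _ (by positivity) |>.2
  refine h2.trans ?_
  have h5 : (20 * √(3 / 2) ^ (k + 1) * √3 ^ k) ^ 2 = 400 * (3 / 2) ^ (k + 1) * 3 ^ k := by
    rw [mul_pow, mul_pow, ← pow_mul, ← pow_mul, mul_comm (k + 1) 2, mul_comm k 2, pow_mul, pow_mul,
      Real.sq_sqrt (by norm_num), Real.sq_sqrt (by norm_num)]
    norm_num
  rw [h5]
  have h6 := mul_le_mul_of_nonneg_right h3 (show (0:ℝ) ≤ 2 * 3 ^ k by positivity)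
  have h7 : (0:ℝ) ≤ (3 / 2) ^ (k + 1) * 3 ^ k := by positivity
  nlinarith

lemma head_bound (k : ℕ) :
    ∑ n ∈ Finset.Ico 1 (3 ^ k), |cantorR n| / √n ≤ 150 * √(3 / 2) ^ k := by
  induction k with
  | zero => simp
  | succ k ih =>
    rw [← Finset.sum_Ico_consecutive _ (Nat.one_le_pow k 3 (by norm_num))
      (Nat.pow_le_pow_right (by norm_num) (Nat.le_succ k))]
    have h := head_block k
    have q : 1.2 ≤ √(3 / 2) := Real.le_sqrt_of_sq_le (by norm_num)
    have q0 : (0:ℝ) ≤ √(3 / 2) ^ k := by positivity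
    rw [pow_succ √(3 / 2) k] at h ⊢
    nlinarith [mul_le_mul_of_nonneg_left q q0]

lemma sep (g : ℕ → ℝ) (a b : ℕ) (lam : ℝ)
    (hinc : ∀ i, a ≤ i → i + 1 < b → lam ≤ g (i + 1) - g i)
    (p q : ℕ) (hp : a ≤ p) (hpq : p ≤ q) (hq : q < b) :
    lam * ((q : ℝ) - p) ≤ g q - g p := by
  induction q, hpq using Nat.le_induction with
  | base => simp
  | succ q hpq ih =>
    have := ih (by omega)
    have := hinc q (by omega) hq
    push_cast
    linarith

lemma count (g : ℕ → ℝ) (a b : ℕ) (lam u δ : ℝ) (hl : 0 < lam) (hδ : 0 ≤ δ)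
    (hinc : ∀ i, a ≤ i → i + 1 < b → lam ≤ g (i + 1) - g i)
    (T : Finset ℕ) (hT : T ⊆ Finset.Ico a b) (h : ∀ n ∈ T, u ≤ g n ∧ g n ≤ u + δ) :
    (T.card : ℝ) ≤ δ / lam + 1 := by
  rcases T.eq_empty_or_nonempty with rfl | hne
  · simp; positivity
  set p := T.min' hne
  set q := T.max' hne
  have hp : p ∈ T := T.min'_mem hne
  have hq : q ∈ T := T.max'_mem hne
  have hpq : p ≤ q := T.min'_le _ hq
  have hsub : T ⊆ Finset.Icc p q := fun n hn =>
    Finset.mem_Icc.2 ⟨T.min'_le _ hn, T.le_max' _ hn⟩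
  have hc := Finset.card_le_card hsub
  rw [Nat.card_Icc] at hc
  have hp' := Finset.mem_Ico.1 (hT hp)
  have hq' := Finset.mem_Ico.1 (hT hq)
  have h1 := sep g a b lam hinc p q hp'.1 hpq hq'.2
  have h2 := (h p hp).1
  have h3 := (h q hq).2
  have h4 : (T.card : ℝ) ≤ (q : ℝ) - p + 1 := by
    have : (T.card : ℝ) + p ≤ q + 1 := by
      have : T.card + p ≤ q + 1 := by omega
      exact_mod_cast this
    linarith
  have h5 : (q : ℝ) - p ≤ δ / lam := by
    rw [le_div_iff₀ hl]; linarith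
  linarith

lemma norm_E (x : ℝ) : ‖Complex.exp (Complex.I * (x : ℂ))‖ = 1 := by
  rw [mul_comm]; exact Complex.norm_exp_ofReal_mul_I _

lemma fiber (f : ℕ → ℝ) (a b : ℕ) (lam δ : ℝ) (k : ℤ) (hl : 0 < lam) (hδ : 0 < δ)
    (hinc : ∀ i, a ≤ i → i + 1 < b →
      lam ≤ (f (i + 2) - f (i + 1)) - (f (i + 1) - f i))
    (T : Finset ℕ)
    (hT : ∀ n, n ∈ T ↔ n ∈ Finset.Ico a b ∧ ⌊(f (n + 1) - f n) / (2 * π)⌋ = k) :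
    ‖∑ n ∈ T, Complex.exp (Complex.I * (f n : ℂ))‖ ≤ 2 * (δ / lam + 1) + 24 / δ := by
  set g : ℕ → ℝ := fun n => f (n + 1) - f n with hg
  have hinc' : ∀ i, a ≤ i → i + 1 < b → lam ≤ g (i + 1) - g i := hinc
  have hπ := Real.pi_pos
  have hTg : ∀ n ∈ T, 2 * π * k ≤ g n ∧ g n < 2 * π * k + 2 * π := by
    intro n hn
    have := ((hT n).1 hn).2
    rw [Int.floor_eq_iff, le_div_iff₀ (by positivity), div_lt_iff₀ (by positivity)] at this
    constructor <;> simp only [hg] <;> linarith [this.1, this.2]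
  have hTs : T ⊆ Finset.Ico a b := fun n hn => ((hT n).1 hn).1
  rw [← Finset.sum_filter_add_sum_filter_not T (fun n => g n < 2 * π * k + δ)]
  rw [← Finset.sum_filter_add_sum_filter_not (T.filter (fun n => ¬ g n < 2 * π * k + δ))
    (fun n => 2 * π * k + 2 * π - δ < g n)]
  have triv : ∀ U : Finset ℕ, ‖∑ n ∈ U, Complex.exp (Complex.I * (f n : ℂ))‖ ≤ U.card := by
    intro U
    refine (norm_sum_le _ _).trans ?_
    simp
  have b1 := (triv (T.filter (fun n => g n < 2 * π * k + δ))).trans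
    (count g a b lam (2 * π * k) δ hl hδ.le hinc' _ ((Finset.filter_subset _ _).trans hTs)
      (fun n hn => by
        rw [Finset.mem_filter] at hn
        exact ⟨(hTg n hn.1).1, hn.2.le⟩))
  have b2 := (triv ((T.filter (fun n => ¬ g n < 2 * π * k + δ)).filter
      (fun n => 2 * π * k + 2 * π - δ < g n))).trans
    (count g a b lam (2 * π * k + 2 * π - δ) δ hl hδ.le hinc' _
      ((Finset.filter_subset _ _).trans ((Finset.filter_subset _ _).trans hTs))
      (fun n hn => by
        rw [Finset.mem_filter, Finset.mem_filter] at hn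
        exact ⟨hn.2.le, by linarith [(hTg n hn.1.1).2]⟩))
  have b3 : ‖∑ n ∈ (T.filter (fun n => ¬ g n < 2 * π * k + δ)).filter
      (fun n => ¬ 2 * π * k + 2 * π - δ < g n), Complex.exp (Complex.I * (f n : ℂ))‖ ≤ 24 / δ := by
    set U := (T.filter (fun n => ¬ g n < 2 * π * k + δ)).filter
      (fun n => ¬ 2 * π * k + 2 * π - δ < g n) with hU
    have hUm : ∀ n, n ∈ U ↔ n ∈ Finset.Ico a b ∧ 2 * π * k + δ ≤ g n
        ∧ g n ≤ 2 * π * k + 2 * π - δ := by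
      intro n
      rw [hU, Finset.mem_filter, Finset.mem_filter]
      constructor
      · rintro ⟨⟨h1, h2⟩, h3⟩
        exact ⟨hTs h1, not_lt.1 h2, not_lt.1 h3⟩
      · rintro ⟨h1, h2, h3⟩
        refine ⟨⟨(hT n).2 ⟨h1, ?_⟩, not_lt.2 h2⟩, not_lt.2 h3⟩
        rw [Int.floor_eq_iff, le_div_iff₀ (by positivity), div_lt_iff₀ (by positivity)]
        simp only [hg] at h2 h3
        constructor <;> linarith
    rcases U.eq_empty_or_nonempty with h0 | hne
    · rw [h0]; simp; positivity
    have hp := U.min'_mem hne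
    have hq := U.max'_mem hne
    set p := U.min' hne
    set q := U.max' hne
    have hp' := (hUm p).1 hp
    have hq' := (hUm q).1 hq
    have hpa := Finset.mem_Ico.1 hp'.1
    have hqa := Finset.mem_Ico.1 hq'.1
    have hbetween : ∀ n, p ≤ n → n ≤ q → 2 * π * k + δ ≤ g n ∧ g n ≤ 2 * π * k + 2 * π - δ := by
      intro n h1 h2
      have s1 := sep g a b lam hinc' p n hpa.1 h1 (by omega)
      have s2 := sep g a b lam hinc' n q (by omega) h2 hqa.2
      have c1 : (p : ℝ) ≤ n := by exact_mod_cast h1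
      have c2 : (n : ℝ) ≤ q := by exact_mod_cast h2
      have := mul_nonneg hl.le (sub_nonneg.2 c1)
      have := mul_nonneg hl.le (sub_nonneg.2 c2)
      exact ⟨by linarith [hp'.2.1], by linarith [hq'.2.2]⟩
    have hUeq : U = Finset.Ico p (q + 1) := by
      ext n
      rw [Finset.mem_Ico]
      constructor
      · intro hn
        exact ⟨U.min'_le _ hn, Nat.lt_succ_of_le (U.le_max' _ hn)⟩
      · rintro ⟨h1, h2⟩
        exact (hUm n).2 ⟨Finset.mem_Ico.2 ⟨by omega, by omega⟩, hbetween n h1 (by omega)⟩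
    rw [hUeq]
    apply KL f p (q + 1) k δ hδ
    · intro i h1 h2
      have := hinc i (by omega) (by omega)
      linarith
    · intro i h1 h2
      exact (hbetween i h1 (by omega)).1
    · intro i h1 h2
      exact (hbetween i h1 (by omega)).2
  refine (norm_add_le _ _).trans ?_
  have := norm_add_le (∑ n ∈ (T.filter (fun n => ¬ g n < 2 * π * k + δ)).filter
      (fun n => 2 * π * k + 2 * π - δ < g n), Complex.exp (Complex.I * (f n : ℂ)))
      (∑ n ∈ (T.filter (fun n => ¬ g n < 2 * π * k + δ)).filter
      (fun n => ¬ 2 * π * k + 2 * π - δ < g n), Complex.exp (Complex.I * (f n : ℂ)))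
  linarith

lemma VdC (f : ℕ → ℝ) (a b : ℕ) (lam δ G R : ℝ) (hl : 0 < lam) (hδ : 0 < δ) (hR : 0 ≤ R)
    (hinc : ∀ i, a ≤ i → i + 1 < b →
      lam ≤ (f (i + 2) - f (i + 1)) - (f (i + 1) - f i))
    (hG : ∀ i, a ≤ i → i < b → G ≤ f (i + 1) - f i ∧ f (i + 1) - f i ≤ G + R) :
    ‖∑ n ∈ Finset.Ico a b, Complex.exp (Complex.I * (f n : ℂ))‖
      ≤ (R + 2) * (2 * (δ / lam + 1) + 24 / δ) := by
  have hπ := Real.pi_gt_three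
  set K : Finset ℤ := Finset.Icc ⌊G / (2 * π)⌋ ⌊(G + R) / (2 * π)⌋ with hK
  have hmaps : ∀ n ∈ Finset.Ico a b, ⌊(f (n + 1) - f n) / (2 * π)⌋ ∈ K := by
    intro n hn
    rw [Finset.mem_Ico] at hn
    have := hG n hn.1 hn.2
    rw [hK, Finset.mem_Icc]
    exact ⟨Int.floor_le_floor (div_le_div_of_nonneg_right this.1 (by positivity)),
      Int.floor_le_floor (div_le_div_of_nonneg_right this.2 (by positivity))⟩
  rw [← Finset.sum_fiberwise_of_maps_to hmaps]
  refine (norm_sum_le _ _).trans ?_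
  have hb : ∀ k ∈ K, ‖∑ n ∈ Finset.Ico a b with ⌊(f (n + 1) - f n) / (2 * π)⌋ = k,
      Complex.exp (Complex.I * (f n : ℂ))‖ ≤ 2 * (δ / lam + 1) + 24 / δ := by
    intro k _
    exact fiber f a b lam δ k hl hδ hinc _ (fun n => by rw [Finset.mem_filter])
  refine (Finset.sum_le_sum hb).trans ?_
  rw [Finset.sum_const, nsmul_eq_mul]
  apply mul_le_mul_of_nonneg_right _ (by positivity)
  rw [hK, Int.card_Icc]
  have h1 : ⌊G / (2 * π)⌋ ≤ ⌊(G + R) / (2 * π)⌋ :=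
    Int.floor_le_floor (div_le_div_of_nonneg_right (by linarith) (by positivity))
  have h2 : (((⌊(G + R) / (2 * π)⌋ + 1 - ⌊G / (2 * π)⌋).toNat : ℤ) : ℝ)
      = ⌊(G + R) / (2 * π)⌋ + 1 - ⌊G / (2 * π)⌋ := by
    rw [Int.toNat_of_nonneg (by omega)]; push_cast; ring
  rw [Int.cast_natCast] at h2
  rw [h2]
  have h3 := Int.floor_le ((G + R) / (2 * π))
  have h4 := Int.lt_floor_add_one (G / (2 * π))
  have h5 : (G + R) / (2 * π) - G / (2 * π) ≤ R := by
    rw [← sub_div, div_le_iff₀ (by positivity)]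
    nlinarith
  linarith

/-- the phase -/
noncomputable def ph (x t : ℝ) (n : ℕ) : ℝ := n * x - t * Real.log n

lemma ph_diff (x t : ℝ) (n : ℕ) (hn : 1 ≤ n) :
    ph x t (n + 1) - ph x t n = x - t * Real.log (1 + 1 / n) := by
  unfold ph
  have : (1 : ℝ) ≤ n := by exact_mod_cast hn
  rw [show (1 : ℝ) + 1 / n = ((n + 1 : ℕ) : ℝ) / n by push_cast; field_simp,
    Real.log_div (by positivity) (by positivity)]
  push_cast
  ring

lemma ph_diff_bds (x t : ℝ) (ht : 0 ≤ t) (n : ℕ) (hn : 1 ≤ n) :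
    x - t / n ≤ ph x t (n + 1) - ph x t n ∧ ph x t (n + 1) - ph x t n ≤ x := by
  rw [ph_diff x t n hn]
  have h1 : (1 : ℝ) ≤ n := by exact_mod_cast hn
  have h2 : Real.log (1 + 1 / n) ≤ 1 / n := by
    have := Real.log_le_sub_one_of_pos (show (0:ℝ) < 1 + 1 / n by positivity)
    linarith
  have h3 : 0 ≤ Real.log (1 + 1 / n) := Real.log_nonneg (by
    have : (0:ℝ) ≤ 1 / n := by positivity
    linarith)
  constructor
  · have := mul_le_mul_of_nonneg_left h2 ht
    rw [mul_one_div] at this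
    linarith
  · nlinarith

lemma ph_inc (x t : ℝ) (ht : 0 ≤ t) (n : ℕ) (hn : 1 ≤ n) :
    t / ((n : ℝ) + 1) ^ 2 ≤
      (ph x t (n + 2) - ph x t (n + 1)) - (ph x t (n + 1) - ph x t n) := by
  rw [ph_diff x t n hn, ph_diff x t (n + 1) (by omega)]
  have h1 : (1 : ℝ) ≤ n := by exact_mod_cast hn
  have h2 : Real.log (1 + 1 / (n : ℝ)) - Real.log (1 + 1 / ((n + 1 : ℕ) : ℝ))
      = - Real.log (1 - 1 / ((n : ℝ) + 1) ^ 2) := by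
    have e : (1 - 1 / ((n : ℝ) + 1) ^ 2) = (1 + 1 / ((n + 1 : ℕ) : ℝ)) / (1 + 1 / (n : ℝ)) := by
      push_cast; field_simp; ring
    rw [e, Real.log_div (by positivity) (by positivity)]
    ring
  have h3 : (0:ℝ) < 1 - 1 / ((n : ℝ) + 1) ^ 2 := by
    rw [sub_pos, div_lt_one (by positivity)]
    nlinarith
  have h4 := Real.log_le_sub_one_of_pos h3
  have h5 : 1 / ((n : ℝ) + 1) ^ 2 ≤
      Real.log (1 + 1 / (n : ℝ)) - Real.log (1 + 1 / ((n + 1 : ℕ) : ℝ)) := by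
    rw [h2]; linarith
  have h6 := mul_le_mul_of_nonneg_left h5 ht
  rw [mul_one_div] at h6
  linarith

lemma block_unweighted (x t : ℝ) (ht : 0 < t) (P b : ℕ) (hP : 1 ≤ P) (hPt : √t ≤ P)
    (hb : b ≤ 3 * P) :
    ‖∑ n ∈ Finset.Ico P b, Complex.exp (Complex.I * (ph x t n : ℂ))‖
      ≤ 80 * √t + 160 * (P / √t) := by
  have hP1 : (1 : ℝ) ≤ P := by exact_mod_cast hP
  have hst : 0 < √t := Real.sqrt_pos.2 ht
  have hss : √t * √t = t := Real.mul_self_sqrt ht.le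
  have h := VdC (ph x t) P b (t / (9 * P ^ 2)) (√t / (3 * P)) (x - t / P) (t / P)
    (by positivity) (by positivity) (by positivity) ?_ ?_
  · refine h.trans ?_
    have e1 : √t / (3 * P) / (t / (9 * P ^ 2)) = 3 * (P / √t) := by
      rw [div_div_div_eq]
      nth_rewrite 2 [← hss]
      field_simp; norm_num
    have e2 : 24 / (√t / (3 * P)) = 72 * (P / √t) := by field_simp; norm_num
    rw [e1, e2]
    have h1 : 1 ≤ P / √t := by rwa [one_le_div hst]
    have e3 : t / P * (P / √t) = √t := by
      nth_rewrite 1 [← hss]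
      field_simp
    have h2 : 2 * (3 * (P / √t) + 1) + 72 * (P / √t) ≤ 80 * (P / √t) := by linarith
    have h3 : 0 ≤ t / P + 2 := by positivity
    have h4 := mul_le_mul_of_nonneg_left h2 h3
    refine h4.trans (le_of_eq ?_)
    rw [show (t / P + 2) * (80 * (P / √t)) = 80 * (t / P * (P / √t)) + 160 * (P / √t) by ring, e3]
  · intro i h1 h2
    refine le_trans ?_ (ph_inc x t ht.le i (by omega))
    apply div_le_div_of_nonneg_left ht.le (by positivity)
    have : (i : ℝ) + 1 ≤ 3 * P := by
      have : i + 1 ≤ 3 * P := by omega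
      exact_mod_cast this
    nlinarith
  · intro i h1 h2
    have := ph_diff_bds x t ht.le i (by omega)
    have h3 : t / i ≤ t / P := by
      apply div_le_div_of_nonneg_left ht.le (by positivity)
      exact_mod_cast h1
    exact ⟨by linarith, by linarith⟩

lemma weighted (x t B : ℝ) (P b : ℕ) (hP : 1 ≤ P) (hB : 0 ≤ B)
    (h : ∀ c, c ≤ b → ‖∑ n ∈ Finset.Ico P c, Complex.exp (Complex.I * (ph x t n : ℂ))‖ ≤ B) :
    ‖∑ n ∈ Finset.Ico P b, (n : ℂ) ^ (-(1 / 2 + t * Complex.I)) * Complex.exp (Complex.I * n * x)‖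
      ≤ 1 / √P * B := by
  have e : ∑ n ∈ Finset.Ico P b, (n : ℂ) ^ (-(1 / 2 + t * Complex.I))
      * Complex.exp (Complex.I * n * x)
      = ∑ n ∈ Finset.Ico P b, ((1 / √n : ℝ) : ℂ) * Complex.exp (Complex.I * (ph x t n : ℂ)) := by
    refine Finset.sum_congr rfl fun n hn => ?_
    have hn1 : 1 ≤ n := hP.trans (Finset.mem_Ico.1 hn).1
    have hn0 : (n : ℂ) ≠ 0 := by exact_mod_cast (by omega : n ≠ 0)
    have hnr : (0:ℝ) < n := by exact_mod_cast hn1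
    have e1 : ((1 / √n : ℝ) : ℂ) = Complex.exp (-(1 / 2) * Real.log n) := by
      have : 1 / √(n:ℝ) = Real.exp (-(1 / 2) * Real.log n) := by
        rw [Real.sqrt_eq_rpow, Real.rpow_def_of_pos hnr, one_div, ← Real.exp_neg]
        congr 1; ring
      rw [this]; push_cast; ring_nf
    rw [Complex.cpow_def_of_ne_zero hn0, e1, ← Complex.exp_add, ← Complex.exp_add,
      ← Complex.natCast_log]
    congr 1
    unfold ph
    push_cast
    ring
  rw [e, Finset.sum_Ico_eq_sum_range]
  have hP1 : (1 : ℝ) ≤ P := by exact_mod_cast hP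
  apply abel (fun i => 1 / √((P + i : ℕ) : ℝ)) (fun i => Complex.exp (Complex.I * (ph x t (P + i) : ℂ)))
    B (1 / √P) (b - P) (by positivity) hB
  · intro i _
    apply one_div_le_one_div_of_le
    · apply Real.sqrt_pos.2; push_cast; positivity
    · apply Real.sqrt_le_sqrt; push_cast; linarith
  · intro i _; positivity
  · intro i _
    apply one_div_le_one_div_of_le
    · apply Real.sqrt_pos.2; positivity
    · apply Real.sqrt_le_sqrt; push_cast; linarith [show (0:ℝ) ≤ i from Nat.cast_nonneg i]
  · intro j hj
    rcases Nat.eq_zero_or_pos j with rfl | hj0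
    · simpa using hB
    have := h (P + j) (by omega)
    rw [Finset.sum_Ico_eq_sum_range] at this
    simpa using this

lemma mid_bound (x t : ℝ) (ht : 0 < t) (K : ℕ) (hK : √t ≤ 3 ^ K) (j : ℕ) (hj : K ≤ j) :
    ‖∑ n ∈ Finset.Ico ((3:ℕ) ^ K) (3 ^ j),
        (n : ℂ) ^ (-(1 / 2 + t * Complex.I)) * Complex.exp (Complex.I * n * x)‖
      ≤ 240 * √t * (1 / √3 ^ K - 1 / √3 ^ j) + 320 * (√3 ^ j / √t) := by
  have hst : 0 < √t := Real.sqrt_pos.2 ht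
  induction j, hj using Nat.le_induction with
  | base => simp; positivity
  | succ j hj ih =>
    have hKj : (3:ℕ) ^ K ≤ 3 ^ j := Nat.pow_le_pow_right (by norm_num) hj
    have hjj : (3:ℕ) ^ j ≤ 3 ^ (j + 1) := Nat.pow_le_pow_right (by norm_num) (Nat.le_succ j)
    rw [← Finset.sum_Ico_consecutive _ hKj hjj]
    refine (norm_add_le _ _).trans ?_
    have hs3 : √((3 ^ j : ℕ) : ℝ) = √3 ^ j := by
      rw [Real.sqrt_eq_iff_mul_self_eq (by positivity) (by positivity), ← mul_pow,
        Real.mul_self_sqrt (by norm_num)]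
      push_cast; rfl
    have hb := weighted x t (80 * √t + 160 * ((3 ^ j : ℕ) / √t)) (3 ^ j) (3 ^ (j + 1))
      (Nat.one_le_pow _ _ (by norm_num)) (by positivity) (fun c hc =>
        block_unweighted x t ht (3 ^ j) c (Nat.one_le_pow _ _ (by norm_num))
          (hK.trans (by exact_mod_cast hKj)) (by rw [pow_succ] at hc; omega))
    rw [hs3] at hb
    have hpos : 0 < √3 ^ j := by positivity
    have e1 : 1 / √3 ^ j * (80 * √t + 160 * ((3 ^ j : ℕ) / √t))
        = 80 * (√t * (1 / √3 ^ j)) + 160 * (√3 ^ j / √t) := by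
      have : ((3 ^ j : ℕ) : ℝ) = √3 ^ j * √3 ^ j := by
        rw [← hs3, Real.mul_self_sqrt (by positivity)]
      rw [this]; field_simp
    rw [e1] at hb
    have q1 : 1.5 ≤ √3 := Real.le_sqrt_of_sq_le (by norm_num)
    have e2 : √t * (1 / √3 ^ (j + 1)) = √t * (1 / √3 ^ j) * (1 / √3) := by
      rw [pow_succ]; field_simp
    have e3 : √3 ^ (j + 1) / √t = √3 ^ j / √t * √3 := by rw [pow_succ]; ring
    have q2 : 1 / √3 ≤ 2 / 3 := by
      rw [div_le_iff₀ (by positivity)]; linarith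
    have p1 : 0 ≤ √t * (1 / √3 ^ j) := by positivity
    have p2 : 0 ≤ √3 ^ j / √t := by positivity
    rw [e3]
    have m1 := mul_le_mul_of_nonneg_left q2 p1
    have m2 := mul_le_mul_of_nonneg_left q1 p2
    rw [← e2] at m1
    linarith

lemma tail_bound (x t : ℝ) (ht : 0 < t) (hx1 : 1 / 2 ≤ x) (hx2 : x ≤ 2) (P b : ℕ) (hP : 1 ≤ P)
    (hPt : 4 * t ≤ P) :
    ‖∑ n ∈ Finset.Ico P b,
        (n : ℂ) ^ (-(1 / 2 + t * Complex.I)) * Complex.exp (Complex.I * n * x)‖ ≤ 96 := by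
  have hP1 : (1 : ℝ) ≤ P := by exact_mod_cast hP
  have hπ := Real.pi_gt_three
  have h := weighted x t 96 P b hP (by norm_num) ?_
  · refine h.trans ?_
    have : 1 / √(P:ℝ) ≤ 1 := by
      rw [div_le_one (by positivity)]
      exact Real.one_le_sqrt.2 hP1
    linarith
  · intro c _
    have bd : ∀ i, P ≤ i → 1 / 4 ≤ ph x t (i + 1) - ph x t i ∧ ph x t (i + 1) - ph x t i ≤ 2 := by
      intro i hi
      have := ph_diff_bds x t ht.le i (by omega)
      have hi' : (P : ℝ) ≤ i := by exact_mod_cast hi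
      have h3 : t / i ≤ 1 / 4 := by
        rw [div_le_iff₀ (by linarith)]; linarith
      exact ⟨by linarith, by linarith⟩
    refine (KL (ph x t) P c 0 (1 / 4) (by norm_num) ?_ ?_ ?_).trans (by norm_num)
    · intro i h1 h2
      have := ph_inc x t ht.le i (by omega)
      have : 0 ≤ t / ((i:ℝ) + 1) ^ 2 := by positivity
      linarith
    · intro i h1 h2
      have := bd i h1
      simp; linarith
    · intro i h1 h2
      have := bd i h1
      simp; linarith

lemma abs_cantorR_le (n : ℕ) : |cantorR n| ≤ 1 := by
  have := cantorR_sq_le n 0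
  simp at this
  exact this

noncomputable def psum (n : ℕ) : ℂ := ∑ i ∈ Finset.range n, cantorA (i + 1)

lemma psum_le (n : ℕ) : ‖psum n‖ ≤ 48 := by
  have h : psum n = ∑ m ∈ Finset.Ico 1 (n + 1), 1 * cantorA m := by
    unfold psum
    rw [Finset.sum_Ico_eq_sum_range]
    simp [add_comm]
  rw [h]
  have hπ := Real.pi_gt_three
  apply transfer
  intro y h1 h2
  have := KL (fun n => n * y) 1 (n + 1) 0 (1 / 2) (by norm_num) (fun i _ _ => by push_cast; linarith)
    (fun i _ _ => by push_cast; linarith) (fun i _ _ => by push_cast; linarith)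
  refine le_trans (le_of_eq ?_) (this.trans (by norm_num))
  congr 1
  refine Finset.sum_congr rfl fun m _ => ?_
  rw [one_mul]
  congr 1
  push_cast
  ring

noncomputable def vv (i : ℕ) (s : ℂ) : ℂ := ((i + 1 : ℕ) : ℂ) ^ (-s)

lemma vv_diff (i : ℕ) (s : ℂ) (hs : 0 < s.re) :
    ‖vv i s - vv (i + 1) s‖ ≤ ‖s‖ * ((i + 1 : ℕ) : ℝ) ^ (-s.re - 1) := by
  have hpos : ∀ u ∈ Set.Icc ((i + 1 : ℕ) : ℝ) ((i + 1 + 1 : ℕ) : ℝ), 0 < u := by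
    intro u hu
    refine lt_of_lt_of_le ?_ hu.1
    positivity
  have h := Convex.norm_image_sub_le_of_norm_hasDerivWithin_le (𝕜 := ℝ)
    (f := fun u : ℝ => (u : ℂ) ^ (-s)) (f' := fun u : ℝ => -s * (u : ℂ) ^ (-s - 1))
    (s := Set.Icc ((i + 1 : ℕ) : ℝ) ((i + 1 + 1 : ℕ) : ℝ))
    (x := ((i + 1 + 1 : ℕ) : ℝ)) (y := ((i + 1 : ℕ) : ℝ))
    (C := ‖s‖ * ((i + 1 : ℕ) : ℝ) ^ (-s.re - 1)) ?_ ?_ (convex_Icc _ _) ?_ ?_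
  · unfold vv
    have e : ‖((i + 1 : ℕ) : ℝ) - ((i + 1 + 1 : ℕ) : ℝ)‖ = 1 := by
      push_cast; rw [show (i:ℝ) + 1 - (i + 1 + 1) = -1 by ring]; simp
    rw [e, mul_one] at h
    simpa using h
  · intro u hu
    have hu0 := hpos u hu
    have h1 : HasDerivAt (fun z : ℂ => z ^ (-s)) (-s * (u : ℂ) ^ (-s - 1)) (u : ℂ) := by
      have := (hasDerivAt_id (u : ℂ)).cpow_const (c := -s) (Or.inl (by simpa using hu0))
      simpa using this
    exact h1.comp_ofReal.hasDerivWithinAt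
  · intro u hu
    have hu0 := hpos u hu
    rw [norm_mul, norm_neg, Complex.norm_cpow_eq_rpow_re_of_pos hu0]
    apply mul_le_mul_of_nonneg_left _ (norm_nonneg _)
    simp only [Complex.sub_re, Complex.neg_re, Complex.one_re]
    exact Real.rpow_le_rpow_of_nonpos (by positivity) hu.1 (by linarith)
  · refine ⟨?_, le_rfl⟩; push_cast; linarith
  · refine ⟨le_rfl, ?_⟩; push_cast; linarith

lemma by_parts (s : ℂ) (N : ℕ) : ∑ i ∈ Finset.range N, cantorA (i + 1) * vv i s
    = psum N * vv N s + ∑ i ∈ Finset.range N, psum (i + 1) * (vv i s - vv (i + 1) s) := by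
  induction N with
  | zero => simp [psum]
  | succ N ih =>
    rw [Finset.sum_range_succ, Finset.sum_range_succ, ih]
    have : psum (N + 1) = psum N + cantorA (N + 1) := by
      unfold psum; rw [Finset.sum_range_succ]
    rw [this]
    ring

lemma norm_vv (i : ℕ) (s : ℂ) : ‖vv i s‖ = ((i + 1 : ℕ) : ℝ) ^ (-s.re) := by
  unfold vv
  rw [Complex.norm_natCast_cpow_of_pos (Nat.succ_pos i)]
  simp

noncomputable def GG (s : ℂ) : ℂ := ∑' i : ℕ, psum (i + 1) * (vv i s - vv (i + 1) s)

lemma GG_term_le (R : ℝ) (i : ℕ) (s : ℂ) (h1 : 1 / 4 < s.re) (h2 : ‖s‖ ≤ R) :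
    ‖psum (i + 1) * (vv i s - vv (i + 1) s)‖ ≤ 48 * R * ((i + 1 : ℕ) : ℝ) ^ (-(5 / 4) : ℝ) := by
  rw [norm_mul, mul_assoc]
  apply mul_le_mul (psum_le _) _ (norm_nonneg _) (by norm_num)
  refine (vv_diff i s (by linarith)).trans ?_
  apply mul_le_mul h2 _ (by positivity) ((norm_nonneg _).trans h2)
  apply Real.rpow_le_rpow_of_exponent_le
  · push_cast; linarith [show (0:ℝ) ≤ i from Nat.cast_nonneg i]
  · linarith

lemma summable_bd (R : ℝ) : Summable (fun i : ℕ => 48 * R * ((i + 1 : ℕ) : ℝ) ^ (-(5 / 4) : ℝ)) := by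
  apply Summable.mul_left
  exact (summable_nat_add_iff (f := fun n : ℕ => (n : ℝ) ^ (-(5 / 4) : ℝ)) 1).2
    (Real.summable_nat_rpow.2 (by norm_num))

lemma GG_tendsto (s : ℂ) (hs : 1 / 4 < s.re) :
    Filter.Tendsto (fun N => ∑ i ∈ Finset.range N, cantorA (i + 1) * vv i s) Filter.atTop
      (nhds (GG s)) := by
  have h1 : Summable (fun i : ℕ => psum (i + 1) * (vv i s - vv (i + 1) s)) :=
    Summable.of_norm_bounded (summable_bd ‖s‖) (fun i => GG_term_le ‖s‖ i s hs le_rfl)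
  have h2 := h1.hasSum.tendsto_sum_nat
  have h3 : Filter.Tendsto (fun N => psum N * vv N s) Filter.atTop (nhds 0) := by
    have h4 : Filter.Tendsto (fun N : ℕ => 48 * ((N + 1 : ℕ) : ℝ) ^ (-s.re)) Filter.atTop (nhds 0) := by
      have h5 := (tendsto_rpow_neg_atTop (y := s.re) (by linarith)).comp
        (tendsto_natCast_atTop_atTop.comp (Filter.tendsto_add_atTop_nat 1))
      simpa using h5.const_mul 48
    refine squeeze_zero_norm (fun N => ?_) h4
    rw [norm_mul, norm_vv]
    exact mul_le_mul_of_nonneg_right (psum_le N) (by positivity)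
  have h6 := h3.add h2
  rw [zero_add] at h6
  refine h6.congr fun N => ?_
  rw [by_parts]

lemma GG_eq_series (s : ℂ) (hs : 1 < s.re) : GG s = cantorSeries s := by
  have hsum : Summable (fun i : ℕ => cantorA (i + 1) * vv i s) := by
    have h0 : Summable (fun i : ℕ => ((i + 1 : ℕ) : ℝ) ^ (-s.re)) :=
      (summable_nat_add_iff (f := fun n : ℕ => (n : ℝ) ^ (-s.re)) 1).2
        (Real.summable_nat_rpow.2 (by linarith))
    refine Summable.of_norm_bounded h0 fun i => ?_
    rw [norm_mul, norm_vv, norm_cantorA]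
    exact mul_le_of_le_one_left (by positivity) (abs_cantorR_le _)
  exact tendsto_nhds_unique (GG_tendsto s (by linarith)) hsum.hasSum.tendsto_sum_nat

lemma L_eq_GG (L : ℂ → ℂ) (hL : Differentiable ℂ L)
    (hLeq : ∀ s : ℂ, 1 < s.re → L s = cantorSeries s) (s : ℂ) (hs : 1 / 4 < s.re) :
    L s = GG s := by
  set R : ℝ := ‖s‖ + 3 with hR
  set U : Set ℂ := {z : ℂ | 1 / 4 < z.re} ∩ Metric.ball 0 R with hU
  have hUo : IsOpen U := (isOpen_lt continuous_const Complex.continuous_re).inter Metric.isOpen_ball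
  have hUc : Convex ℝ U := (convex_halfSpace_re_gt (1 / 4)).inter (convex_ball 0 R)
  have hG : DifferentiableOn ℂ GG U := by
    refine differentiableOn_tsum_of_summable_norm (summable_bd R) ?_ hUo ?_
    · intro i
      apply Differentiable.differentiableOn
      have hv : ∀ i, Differentiable ℂ (vv i) := by
        intro i
        unfold vv
        have : ((i + 1 : ℕ) : ℂ) ≠ 0 := by exact_mod_cast Nat.succ_ne_zero i
        exact differentiable_neg.const_cpow (Or.inl this)
      exact ((hv i).sub (hv (i + 1))).const_mul _
    · intro i z hz
      exact GG_term_le R i z hz.1 (by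
        have := hz.2; rw [mem_ball_zero_iff] at this; exact this.le)
  have h2 : (2 : ℂ) ∈ U := by
    refine ⟨by show (1 / 4 : ℝ) < (2 : ℂ).re; norm_num, ?_⟩
    rw [mem_ball_zero_iff, hR]
    have := norm_nonneg s
    simp; linarith
  have hsU : s ∈ U := ⟨hs, by rw [mem_ball_zero_iff, hR]; linarith⟩
  have hev : L =ᶠ[nhds 2] GG := by
    have : {z : ℂ | 1 < z.re} ∈ nhds (2 : ℂ) :=
      (isOpen_lt continuous_const Complex.continuous_re).mem_nhds (by simp)
    filter_upwards [this] with z hz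
    rw [hLeq z hz, GG_eq_series z hz]
  exact AnalyticOnNhd.eqOn_of_preconnected_of_eventuallyEq
    (hL.differentiableOn.analyticOnNhd hUo) (hG.analyticOnNhd hUo) hUc.isPreconnected h2 hev hsU

lemma sqrt3_pow (j : ℕ) : √3 ^ j = √(3 ^ j) := by
  rw [eq_comm, Real.sqrt_eq_iff_mul_self_eq (by positivity) (by positivity), ← mul_pow,
    Real.mul_self_sqrt (by norm_num)]

lemma partial_bound (t : ℝ) (ht : 2 ≤ t) (K j N : ℕ) (hK : √t ≤ 3 ^ K) (hKj : K ≤ j)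
    (hj1 : 4 * t ≤ 3 ^ j) (hj2 : (3:ℝ) ^ j ≤ 12 * t) (hN : 3 ^ j ≤ N) :
    ‖∑ i ∈ Finset.range N, cantorA (i + 1) * vv i (1 / 2 + t * Complex.I)‖
      ≤ 150 * √(3 / 2) ^ K + 240 * (√t / √3 ^ K) + 1376 := by
  have ht0 : 0 < t := by linarith
  have hst : 0 < √t := Real.sqrt_pos.2 ht0
  set c : ℕ → ℂ := fun n => (n : ℂ) ^ (-(1 / 2 + t * Complex.I)) with hc
  have e : ∑ i ∈ Finset.range N, cantorA (i + 1) * vv i (1 / 2 + t * Complex.I)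
      = ∑ n ∈ Finset.Ico 1 (N + 1), c n * cantorA n := by
    rw [Finset.sum_Ico_eq_sum_range]
    refine Finset.sum_congr (by simp) fun i _ => ?_
    unfold vv
    rw [hc, add_comm 1 i, mul_comm]
  have h1K : 1 ≤ 3 ^ K := Nat.one_le_pow _ _ (by norm_num)
  have hKj' : (3:ℕ) ^ K ≤ 3 ^ j := Nat.pow_le_pow_right (by norm_num) hKj
  rw [e, ← Finset.sum_Ico_consecutive _ h1K (show 3 ^ K ≤ N + 1 by omega),
    ← Finset.sum_Ico_consecutive _ hKj' (show 3 ^ j ≤ N + 1 by omega)]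
  have b1 : ‖∑ n ∈ Finset.Ico 1 (3 ^ K), c n * cantorA n‖ ≤ 150 * √(3 / 2) ^ K := by
    refine le_trans ?_ (head_bound K)
    refine (norm_sum_le _ _).trans (Finset.sum_le_sum fun n hn => ?_)
    have hn1 : 0 < n := (Finset.mem_Ico.1 hn).1
    rw [norm_mul, norm_cantorA, hc, Complex.norm_natCast_cpow_of_pos hn1]
    apply le_of_eq
    have : (-(1 / 2 + (t : ℂ) * Complex.I)).re = -(1 / 2) := by simp
    rw [this, Real.rpow_neg (by positivity), ← Real.sqrt_eq_rpow]
    field_simp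
  have b2 : ‖∑ n ∈ Finset.Ico (3 ^ K) (3 ^ j), c n * cantorA n‖
      ≤ 240 * √t * (1 / √3 ^ K - 1 / √3 ^ j) + 320 * (√3 ^ j / √t) :=
    transfer _ _ _ fun y _ _ => mid_bound y t ht0 K hK j hKj
  have b3 : ‖∑ n ∈ Finset.Ico (3 ^ j) (N + 1), c n * cantorA n‖ ≤ 96 :=
    transfer _ _ _ fun y h1 h2 => tail_bound y t ht0 h1 h2 (3 ^ j) (N + 1)
      (Nat.one_le_pow _ _ (by norm_num)) (by push_cast; exact hj1)
  have b4 : √3 ^ j / √t ≤ 4 := by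
    rw [div_le_iff₀ hst, sqrt3_pow]
    apply Real.sqrt_le_iff.2
    refine ⟨by positivity, ?_⟩
    rw [mul_pow, Real.sq_sqrt ht0.le]
    linarith
  have b5 : 240 * √t * (1 / √3 ^ K - 1 / √3 ^ j) ≤ 240 * (√t / √3 ^ K) := by
    have : 0 ≤ 240 * √t * (1 / √3 ^ j) := by positivity
    have e2 : 240 * √t * (1 / √3 ^ K) = 240 * (√t / √3 ^ K) := by ring
    rw [mul_sub, e2]
    linarith
  refine (norm_add_le _ _).trans ?_
  have := norm_add_le (∑ n ∈ Finset.Ico (3 ^ K) (3 ^ j), c n * cantorA n)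
    (∑ n ∈ Finset.Ico (3 ^ j) (N + 1), c n * cantorA n)
  linarith

lemma dim_facts : 0 < cantorDim ∧ cantorDim < 1 ∧ (3:ℝ) ^ (1 - cantorDim) = 3 / 2 := by
  have l2 : 0 < Real.log 2 := Real.log_pos (by norm_num)
  have l3 : 0 < Real.log 3 := Real.log_pos (by norm_num)
  have l23 : Real.log 2 < Real.log 3 := Real.log_lt_log (by norm_num) (by norm_num)
  refine ⟨div_pos l2 l3, (div_lt_one l3).2 l23, ?_⟩
  rw [Real.rpow_def_of_pos (by norm_num), mul_sub, mul_one]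
  unfold cantorDim
  rw [mul_div_cancel₀ _ l3.ne', ← Real.log_div (by norm_num) (by norm_num),
    Real.exp_log (by norm_num)]

lemma main_bound (L : ℂ → ℂ) (hL : Differentiable ℂ L)
    (hLeq : ∀ s : ℂ, 1 < s.re → L s = cantorSeries s) (t : ℝ) (ht : 2 ≤ t) :
    ‖L (1 / 2 + t * Complex.I)‖ ≤ 2066 * t ^ ((1 - cantorDim) / (2 * (2 - cantorDim))) := by
  obtain ⟨d0, d1, d3⟩ := dim_facts
  generalize cantorDim = d at *
  have ht0 : 0 < t := by linarith
  have ht1 : 1 ≤ t := by linarith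
  set q : ℝ := 1 / (2 - d) with hq
  have hq1 : q ≤ 1 := by rw [hq, div_le_one (by linarith)]; linarith
  have hq2 : 1 / 2 ≤ q := by rw [hq]; exact one_div_le_one_div_of_le (by linarith) (by linarith)
  set T : ℝ := t ^ q with hT
  have hT1 : 1 ≤ T := Real.one_le_rpow ht1 (by linarith)
  have hTt : T ≤ t := by
    have := Real.rpow_le_rpow_of_exponent_le ht1 hq1
    rwa [Real.rpow_one] at this
  have hTs : √t ≤ T := by
    rw [Real.sqrt_eq_rpow]; exact Real.rpow_le_rpow_of_exponent_le ht1 hq2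
  obtain ⟨n, hn1, hn2⟩ := exists_nat_pow_near hT1 (show (1:ℝ) < 3 by norm_num)
  obtain ⟨m, hm1, hm2⟩ := exists_nat_pow_near (show (1:ℝ) ≤ 4 * t by linarith)
    (show (1:ℝ) < 3 by norm_num)
  set K := n + 1 with hK
  have hKT : (3:ℝ) ^ K ≤ 3 * T := by rw [hK, pow_succ]; linarith
  set j := max K (m + 1) with hj
  have hj1 : 4 * t ≤ 3 ^ j := hm2.le.trans (pow_le_pow_right₀ (by norm_num) (le_max_right _ _))
  have hj2 : (3:ℝ) ^ j ≤ 12 * t := by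
    rcases max_choice K (m + 1) with h | h
    · rw [hj, h]; linarith
    · rw [hj, h, pow_succ]; linarith
  set E : ℝ := t ^ ((1 - d) / (2 * (2 - d))) with hE
  have hE1 : 1 ≤ E := Real.one_le_rpow ht1 (div_nonneg (by linarith) (by linarith))
  have c1 : √(3 / 2) ^ K ≤ 3 * E := by
    have e1 : √(3 / 2) ^ K = ((3:ℝ) ^ K) ^ ((1 - d) / 2) := by
      rw [← d3, Real.sqrt_eq_rpow, ← Real.rpow_mul (by norm_num), ← Real.rpow_natCast,
        ← Real.rpow_natCast, ← Real.rpow_mul (by norm_num), ← Real.rpow_mul (by norm_num)]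
      congr 1; ring
    rw [e1]
    refine (Real.rpow_le_rpow (by positivity) hKT (by linarith)).trans ?_
    rw [Real.mul_rpow (by norm_num) (by linarith)]
    have e2 : T ^ ((1 - d) / 2) = E := by
      rw [hT, hE, ← Real.rpow_mul ht0.le]
      congr 1
      rw [hq]
      have : 2 - d ≠ 0 := by linarith
      field_simp
    rw [e2]
    apply mul_le_mul_of_nonneg_right _ (by linarith)
    have := Real.rpow_le_rpow_of_exponent_le (show (1:ℝ) ≤ 3 by norm_num)
      (show (1 - d) / 2 ≤ 1 by linarith)
    rwa [Real.rpow_one] at this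
  have c2 : √t / √3 ^ K ≤ E := by
    rw [sqrt3_pow]
    have h1 : √T ≤ √(3 ^ K) := Real.sqrt_le_sqrt hn2.le
    have h2 : 0 < √T := Real.sqrt_pos.2 (by linarith)
    refine (div_le_div_of_nonneg_left (Real.sqrt_nonneg t) h2 h1).trans (le_of_eq ?_)
    rw [Real.sqrt_eq_rpow, Real.sqrt_eq_rpow, hT, hE, ← Real.rpow_mul ht0.le,
      ← Real.rpow_sub ht0]
    congr 1
    rw [hq]
    have : 2 - d ≠ 0 := by linarith
    field_simp
    ring
  have hre : 1 / 4 < (1 / 2 + t * Complex.I : ℂ).re := by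
    have : (1 / 2 + t * Complex.I : ℂ).re = 1 / 2 := by simp
    rw [this]; norm_num
  rw [L_eq_GG L hL hLeq _ hre]
  refine le_of_tendsto (GG_tendsto _ hre).norm ?_
  filter_upwards [Filter.eventually_ge_atTop (3 ^ j)] with N hN
  have := partial_bound t ht K j N (hTs.trans hn2.le) (le_max_left _ _) hj1 hj2 hN
  linarith

end CantorAux

/-- Asymmetric-AFE subconvexity for the Cantor Dirichlet series:
`|L(1/2+it)| ≪_ε t^{(1−d)/(2(2−d))+ε}`. -/
theorem cantor_subconvexity
    (L : ℂ → ℂ) (hL : Differentiable ℂ L)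
    (hLeq : ∀ s : ℂ, 1 < s.re → L s = cantorSeries s) :
    ∀ ε : ℝ, 0 < ε → ∃ K : ℝ, ∀ t : ℝ, 2 ≤ t →
      ‖L (1 / 2 + t * Complex.I)‖ ≤
        K * t ^ ((1 - cantorDim) / (2 * (2 - cantorDim)) + ε) := by
  intro ε hε
  refine ⟨2066, fun t ht => (CantorAux.main_bound L hL hLeq t ht).trans ?_⟩
  apply mul_le_mul_of_nonneg_left _ (by norm_num)
  exact Real.rpow_le_rpow_of_exponent_le (by linarith) (by linarith)
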